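/- arXiv:1108.2903 — 3 statements merged into one kernel-verified Lean document; each statement's English description precedes it below -/
import Mathlib

section
/- Let $W_c, W_o \in M_n(\mathbb{R})$ be symmetric positive definite matrices. Then there exist an invertible matrix $Q \in M_n(\mathbb{R})$ and real numbers $\sigma_1 \ge \sigma_2 \ge \dots \ge \sigma_n > 0$ such that $Q W_c Q^{\top} = Q^{-\top} W_o Q^{-1} = \mathrm{diag}(\sigma_1, \dots, \sigma_n)$, and $\sigma_1^2, \dots, \sigma_n^2$ are exactly the eigenvalues of $W_o W_c$ counted with multiplicity. (Existence of a balanced realization, Theorem 2.1; the numbers $\sigma_i$ are the Hankel singular values.) -/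
open Matrix Polynomial

/-- A real positive definite matrix is orthogonally diagonalizable with its (positive)
eigenvalues listed in decreasing order. -/
theorem Matrix.PosDef.exists_orthogonal_antitone_diagonalization {n : ℕ}
    {M : Matrix (Fin n) (Fin n) ℝ} (hM : M.PosDef) :
    ∃ (U : Matrix (Fin n) (Fin n) ℝ) (d : Fin n → ℝ),
      Uᵀ * U = 1 ∧ (∀ i, 0 < d i) ∧ Antitone d ∧ M = U * diagonal d * Uᵀ := by
  let V : Matrix (Fin n) (Fin n) ℝ := hM.1.eigenvectorUnitary
  let e : Equiv.Perm (Fin n) := Tuple.sort (-hM.1.eigenvalues)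
  have hV : Vᵀ * V = 1 := by
    simpa [star_eq_conjTranspose] using Unitary.coe_star_mul_self hM.1.eigenvectorUnitary
  have hMV : M = V * diagonal hM.1.eigenvalues * Vᵀ := by
    have h := hM.1.spectral_theorem
    rw [Unitary.conjStarAlgAut_apply] at h
    simpa [star_eq_conjTranspose, Function.comp_def] using h
  refine ⟨V.submatrix id e, hM.1.eigenvalues ∘ e, ?_, fun i => hM.eigenvalues_pos _, ?_, ?_⟩
  · rw [transpose_submatrix, submatrix_mul _ _ _ id _ Function.bijective_id |>.symm, hV,
      submatrix_one_equiv]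
  · intro i j hij
    have h := Tuple.monotone_sort (-hM.1.eigenvalues) hij
    simpa using h
  · rw [← submatrix_diagonal_equiv, transpose_submatrix, submatrix_mul_equiv,
      submatrix_mul_equiv, submatrix_id_id]
    exact hMV

/-- A real positive definite matrix factors as `S * Sᵀ` with `S` invertible. -/
theorem Matrix.PosDef.exists_isUnit_mul_transpose {n : ℕ}
    {M : Matrix (Fin n) (Fin n) ℝ} (hM : M.PosDef) :
    ∃ S : Matrix (Fin n) (Fin n) ℝ, IsUnit S ∧ M = S * Sᵀ := by
  obtain ⟨U, d, -, hd, -, hMU⟩ := hM.exists_orthogonal_antitone_diagonalization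
  have hfac : M = U * diagonal (fun i => √(d i)) * (U * diagonal (fun i => √(d i)))ᵀ := by
    have hsq : diagonal d = diagonal (fun i => √(d i)) * diagonal (fun i => √(d i)) := by
      simp [diagonal_mul_diagonal, Real.mul_self_sqrt (hd _).le]
    rw [hMU, hsq, transpose_mul, diagonal_transpose]
    simp only [Matrix.mul_assoc]
  refine ⟨_, ?_, hfac⟩
  have h := hM.isUnit
  rw [hfac] at h
  exact isUnit_of_mul_isUnit_left h

/-- The characteristic polynomial of the product of two Gramians balanced by `Q`. -/
theorem charpoly_mul_of_balanced {n : ℕ} {Wc Wo Q : Matrix (Fin n) (Fin n) ℝ} {σ : Fin n → ℝ}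
    (hQ : IsUnit Q) (hc : Q * Wc * Qᵀ = diagonal σ) (ho : (Q⁻¹)ᵀ * Wo * Q⁻¹ = diagonal σ) :
    (Wo * Wc).charpoly = ∏ i : Fin n, (X - C (σ i ^ 2)) := by
  have hdet : IsUnit Q.det := (isUnit_iff_isUnit_det Q).mp hQ
  have hT : Qᵀ * (Q⁻¹)ᵀ = 1 := by
    rw [← transpose_mul, nonsing_inv_mul _ hdet, transpose_one]
  have hconj : (Q⁻¹)ᵀ * (Wo * Wc) * Qᵀ = diagonal fun i => σ i ^ 2 := by
    calc (Q⁻¹)ᵀ * (Wo * Wc) * Qᵀ = (Q⁻¹)ᵀ * Wo * (Q⁻¹ * Q) * Wc * Qᵀ := by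
          rw [nonsing_inv_mul _ hdet]
          simp only [Matrix.mul_assoc, Matrix.one_mul]
      _ = (Q⁻¹)ᵀ * Wo * Q⁻¹ * (Q * Wc * Qᵀ) := by simp only [Matrix.mul_assoc]
      _ = diagonal fun i => σ i ^ 2 := by rw [ho, hc, diagonal_mul_diagonal]; simp only [sq]
  rw [← charpoly_diagonal, ← hconj, charpoly_mul_comm _ Qᵀ, ← Matrix.mul_assoc, hT,
    Matrix.one_mul]

/-- Existence of a balanced realization: two symmetric positive definite Gramians can be
simultaneously transformed (as `Wc ↦ Q Wc Qᵀ`, `Wo ↦ Q⁻ᵀ Wo Q⁻¹`) into the same diagonal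
matrix of Hankel singular values `σ₁ ≥ ⋯ ≥ σₙ > 0`, whose squares are exactly the
eigenvalues (with multiplicity) of `Wo * Wc`. -/
theorem stmt1 {n : ℕ} (Wc Wo : Matrix (Fin n) (Fin n) ℝ)
    (hWc : Wc.PosDef) (hWo : Wo.PosDef) :
    ∃ (Q : Matrix (Fin n) (Fin n) ℝ) (σ : Fin n → ℝ),
      IsUnit Q ∧
      (∀ i, 0 < σ i) ∧
      (∀ i j : Fin n, i ≤ j → σ j ≤ σ i) ∧
      Q * Wc * Qᵀ = Matrix.diagonal σ ∧
      (Q⁻¹)ᵀ * Wo * Q⁻¹ = Matrix.diagonal σ ∧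
      (Wo * Wc).charpoly = ∏ i : Fin n, (X - C (σ i ^ 2)) := by
  obtain ⟨S, hS, hWcS⟩ := hWc.exists_isUnit_mul_transpose
  have hSdet : IsUnit S.det := (isUnit_iff_isUnit_det S).mp hS
  have hM : (Sᵀ * Wo * S).PosDef := by
    simpa using hWo.conjTranspose_mul_mul_same (mulVec_injective_of_isUnit hS)
  obtain ⟨U, d, hU, hd, hanti, hMU⟩ := hM.exists_orthogonal_antitone_diagonalization
  have hσ : ∀ i, 0 < √(d i) := fun i => Real.sqrt_pos.mpr (hd i)
  let s : Fin n → ℝ := fun i => √√(d i)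
  have hs : ∀ i, s i ≠ 0 := fun i => (Real.sqrt_pos.mpr (hσ i)).ne'
  have hss : ∀ i, s i * s i = √(d i) := fun i => Real.mul_self_sqrt (hσ i).le
  let Q := diagonal s * Uᵀ * S⁻¹
  let P := S * U * diagonal s⁻¹
  have hQP : Q * P = 1 := by
    calc Q * P = diagonal s * (Uᵀ * (S⁻¹ * S) * U) * diagonal s⁻¹ := by
          simp only [Q, P, Matrix.mul_assoc]
      _ = 1 := by
          rw [nonsing_inv_mul _ hSdet, Matrix.mul_one, hU, Matrix.mul_one, diagonal_mul_diagonal]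
          simp [hs]
  have hQ : IsUnit Q := .of_mul_eq_one P hQP
  have hc : Q * Wc * Qᵀ = diagonal fun i => √(d i) := by
    calc Q * Wc * Qᵀ = diagonal s * (Uᵀ * (S⁻¹ * S) * (S⁻¹ * S)ᵀ * U) * diagonal s := by
          simp only [Q, hWcS, transpose_mul, diagonal_transpose, transpose_transpose,
            Matrix.mul_assoc]
      _ = diagonal fun i => √(d i) := by
          rw [nonsing_inv_mul _ hSdet, transpose_one, Matrix.mul_one, Matrix.mul_one, hU,
            Matrix.mul_one, diagonal_mul_diagonal]
          simp only [hss]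
  have ho : (Q⁻¹)ᵀ * Wo * Q⁻¹ = diagonal fun i => √(d i) := by
    rw [inv_eq_right_inv hQP]
    calc Pᵀ * Wo * P = diagonal s⁻¹ * Uᵀ * (Sᵀ * Wo * S) * U * diagonal s⁻¹ := by
          simp only [P, transpose_mul, diagonal_transpose, Matrix.mul_assoc]
      _ = diagonal s⁻¹ * (Uᵀ * U) * diagonal d * (Uᵀ * U) * diagonal s⁻¹ := by
          rw [hMU]
          simp only [Matrix.mul_assoc]
      _ = diagonal fun i => √(d i) := by
          rw [hU, Matrix.mul_one, Matrix.mul_one, diagonal_mul_diagonal, diagonal_mul_diagonal]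
          congr 1
          ext i
          have hi := hs i
          have hdi : d i = s i * s i * (s i * s i) := by
            rw [hss, Real.mul_self_sqrt (hd i).le]
          rw [← hss, hdi, Pi.inv_apply]
          field_simp
  exact ⟨Q, _, hQ, hσ, fun i j hij => Real.sqrt_le_sqrt (hanti hij), hc, ho,
    charpoly_mul_of_balanced hQ hc ho⟩
end

section
/- Let $W_c, W_o \in M_n(\mathbb{R})$ be symmetric positive definite. Suppose $Z \in M_n(\mathbb{R})$ is invertible with $W_o = Z Z^{\top}$, $U \in M_n(\mathbb{R})$ is orthogonal, and $\Sigma = \mathrm{diag}(\sigma_1,\dots,\sigma_n)$ with all $\sigma_i > 0$ satisfies $Z^{\top} W_c Z = U \Sigma^2 U^{\top}$. Then the matrix $Q := \Sigma^{1/2} U^{\top} Z^{-1}$ is invertible and simultaneously diagonalizes the two Gramians: $Q W_o Q^{\top} = \Sigma$ and $Q^{-\top} W_c Q^{-1} = \Sigma$. (Explicit construction of a balancing transformation from a Cholesky factorization and an SVD.) -/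
open Matrix

/-- Explicit construction of a balancing transformation from a Cholesky factorization
`Wo = Z Zᵀ` and an SVD `Zᵀ Wc Z = U Σ² Uᵀ`: the matrix `Q = Σ^(1/2) Uᵀ Z⁻¹` is invertible
and satisfies `Q Wo Qᵀ = Σ` and `Q⁻ᵀ Wc Q⁻¹ = Σ`. -/
theorem stmt2 {n : ℕ} (Wc Wo Z U : Matrix (Fin n) (Fin n) ℝ) (σ : Fin n → ℝ)
    (hWc : Wc.PosDef) (hWo : Wo.PosDef)
    (hZ : IsUnit Z) (hZWo : Wo = Z * Zᵀ)
    (hU : Uᵀ * U = 1) (hU' : U * Uᵀ = 1)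
    (hσ : ∀ i, 0 < σ i)
    (hSVD : Zᵀ * Wc * Z = U * Matrix.diagonal (fun i => σ i ^ 2) * Uᵀ)
    (Q : Matrix (Fin n) (Fin n) ℝ)
    (hQ : Q = Matrix.diagonal (fun i => Real.sqrt (σ i)) * Uᵀ * Z⁻¹) :
    IsUnit Q ∧
    Q * Wo * Qᵀ = Matrix.diagonal σ ∧
    (Q⁻¹)ᵀ * Wc * Q⁻¹ = Matrix.diagonal σ := by
  have hZl : Z⁻¹ * Z = 1 := nonsing_inv_mul Z ((isUnit_iff_isUnit_det Z).mp hZ)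
  set D : Matrix (Fin n) (Fin n) ℝ := diagonal (fun i => Real.sqrt (σ i)) with hD
  set E : Matrix (Fin n) (Fin n) ℝ := diagonal (fun i => (Real.sqrt (σ i))⁻¹) with hE
  have hDE : D * E = 1 := by
    rw [hD, hE, diagonal_mul_diagonal, ← diagonal_one]
    congr 1
    ext i
    exact mul_inv_cancel₀ (Real.sqrt_pos.mpr (hσ i)).ne'
  have hDD : D * D = diagonal σ := by
    rw [hD, diagonal_mul_diagonal]
    congr 1
    ext i
    exact Real.mul_self_sqrt (hσ i).le
  have hDt : Dᵀ = D := diagonal_transpose _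
  have hEt : Eᵀ = E := diagonal_transpose _
  have hQinv : Q * (Z * U * E) = 1 := by
    calc Q * (Z * U * E) = D * (Uᵀ * ((Z⁻¹ * Z) * U)) * E := by
          rw [hQ]; simp only [Matrix.mul_assoc]
      _ = 1 := by rw [hZl, Matrix.one_mul, hU, Matrix.mul_one, hDE]
  have hQi : Q⁻¹ = Z * U * E := inv_eq_right_inv hQinv
  refine ⟨IsUnit.of_mul_eq_one _ hQinv, ?_, ?_⟩
  · calc Q * Wo * Qᵀ = D * (Uᵀ * ((Z⁻¹ * Z) * (Z⁻¹ * Z)ᵀ) * U) * D := by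
          rw [hQ, hZWo]
          simp only [transpose_mul, transpose_transpose, hDt, Matrix.mul_assoc]
      _ = diagonal σ := by
          rw [hZl, transpose_one, Matrix.mul_one, Matrix.mul_one, hU, Matrix.mul_one, hDD]
  · calc (Q⁻¹)ᵀ * Wc * Q⁻¹ = E * (Uᵀ * (Zᵀ * Wc * Z) * U) * E := by
          rw [hQi]
          simp only [transpose_mul, hEt, Matrix.mul_assoc]
      _ = E * ((Uᵀ * U) * diagonal (fun i => σ i ^ 2) * (Uᵀ * U)) * E := by
          rw [hSVD]
          simp only [Matrix.mul_assoc]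
      _ = diagonal σ := by
          rw [hU, Matrix.one_mul, Matrix.mul_one, hE, diagonal_mul_diagonal,
            diagonal_mul_diagonal]
          congr 1
          ext i
          have hs := (Real.sqrt_pos.mpr (hσ i)).ne'
          have hsq := Real.sq_sqrt (hσ i).le
          field_simp
          rw [hsq]
          ring
end

section
/- (Observability energy solves the Lyapunov PDE, Theorem 2.3, first part.) Let $f : \mathbb{R}^n \to \mathbb{R}^n$ be $C^1$ with $f(0)=0$ and $h : \mathbb{R}^n \to \mathbb{R}^p$ continuous with $h(0)=0$. Let $W \subseteq \mathbb{R}^n$ be an open neighborhood of $0$ and suppose that for each $x \in W$ there is a solution $\varphi(\cdot,x) : [0,\infty) \to W$ of $\tfrac{d}{dt}\varphi(t,x) = f(\varphi(t,x))$, $\varphi(0,x)=x$, with $\varphi(t,x) \to 0$ as $t \to \infty$, and that $L_o(x) := \tfrac12 \int_0^\infty \|h(\varphi(t,x))\|^2 dt$ is finite for each $x \in W$. Then: (i) $L_o(0)=0$; (ii) if $L_o$ is differentiable on $W$, then for all $x \in W$, $\langle \nabla L_o(x), f(x)\rangle + \tfrac12 \|h(x)\|^2 = 0$; and (iii) $L_o$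 is the unique such solution: if $L : W \to \mathbb{R}$ is $C^1$ with $L(0)=0$ and $\langle \nabla L(x), f(x)\rangle + \tfrac12\|h(x)\|^2 = 0$ for all $x \in W$, then $L = L_o$ on $W$. -/
open MeasureTheory Filter
open scoped RealInnerProductSpace

open Set in
/-- Two forward solutions of an autonomous locally Lipschitz ODE with the same initial value
agree for all nonnegative times. -/
theorem forward_solution_unique {E : Type*} [NormedAddCommGroup E] [NormedSpace ℝ E]
    {f : E → E} (hf : LocallyLipschitz f) {u v : ℝ → E}
    (hu : ∀ t : ℝ, 0 ≤ t → HasDerivWithinAt u (f (u t)) (Ici 0) t)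
    (hv : ∀ t : ℝ, 0 ≤ t → HasDerivWithinAt v (f (v t)) (Ici 0) t)
    (huv : u 0 = v 0) {t : ℝ} (ht : 0 ≤ t) : u t = v t := by
  have huc : ContinuousOn u (Icc 0 t) := fun r hr =>
    (hu r hr.1).continuousWithinAt.mono Icc_subset_Ici_self
  have hvc : ContinuousOn v (Icc 0 t) := fun r hr =>
    (hv r hr.1).continuousWithinAt.mono Icc_subset_Ici_self
  obtain ⟨K, hK⟩ := (hf.locallyLipschitzOn
    (s := u '' Icc 0 t ∪ v '' Icc 0 t)).exists_lipschitzOnWith_of_compact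
      ((isCompact_Icc.image_of_continuousOn huc).union (isCompact_Icc.image_of_continuousOn hvc))
  exact ODE_solution_unique_of_mem_Icc_right (v := fun _ => f)
    (s := fun _ => u '' Icc 0 t ∪ v '' Icc 0 t) (fun _ _ => hK)
    huc (fun r hr => (hu r hr.1).mono (Ici_subset_Ici.2 hr.1))
    (fun r hr => Or.inl (mem_image_of_mem u (Ico_subset_Icc_self hr)))
    hvc (fun r hr => (hv r hr.1).mono (Ici_subset_Ici.2 hr.1))
    (fun r hr => Or.inr (mem_image_of_mem v (Ico_subset_Icc_self hr)))
    huv (right_mem_Icc.2 ht)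

theorem setIntegral_Ioi_comp_const_add {E : Type*} [NormedAddCommGroup E] [NormedSpace ℝ E]
    (g : ℝ → E) (s a : ℝ) :
    ∫ t in Set.Ioi a, g (s + t) = ∫ t in Set.Ioi (s + a), g t := by
  have := (measurePreserving_add_left volume s).setIntegral_preimage_emb
    (measurableEmbedding_addLeft s) g (Set.Ioi (s + a))
  simpa using this

/-- The derivative of a primitive over `[0, s]` at `s = 0` from the right. -/
theorem hasDerivWithinAt_integral_Ici_zero {g : ℝ → ℝ} (hg : ContinuousOn g (Set.Ici 0)) :
    HasDerivWithinAt (fun s => ∫ t in (0 : ℝ)..s, g t) (g 0) (Set.Ici 0) 0 :=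
  intervalIntegral.integral_hasDerivWithinAt_right (t := Set.Ioi 0) (by simp)
    ((hg.mono Set.Ioi_subset_Ici_self).stronglyMeasurableAtFilter_nhdsWithin measurableSet_Ioi 0)
    ((hg 0 Set.self_mem_Ici).mono Set.Ioi_subset_Ici_self)

/-- The observability energy `L_o(x) = ½∫₀^∞ ‖h(φ(t,x))‖² dt` of `ẋ = f(x)`, `y = h(x)`
vanishes at `0`, solves the Lyapunov PDE `⟨∇L_o(x), f(x)⟩ + ½‖h(x)‖² = 0` on `W` wherever
it is differentiable, and is the unique `C¹` solution of that PDE vanishing at `0`. -/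
theorem stmt7 {n p : ℕ}
    (f : EuclideanSpace ℝ (Fin n) → EuclideanSpace ℝ (Fin n))
    (h : EuclideanSpace ℝ (Fin n) → EuclideanSpace ℝ (Fin p))
    (hf : ContDiff ℝ 1 f) (hf0 : f 0 = 0) (hh : Continuous h) (hh0 : h 0 = 0)
    (W : Set (EuclideanSpace ℝ (Fin n))) (hW : IsOpen W) (h0W : (0 : EuclideanSpace ℝ (Fin n)) ∈ W)
    (φ : EuclideanSpace ℝ (Fin n) → ℝ → EuclideanSpace ℝ (Fin n))
    (hφ0 : ∀ x ∈ W, φ x 0 = x)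
    (hφW : ∀ x ∈ W, ∀ t : ℝ, 0 ≤ t → φ x t ∈ W)
    (hφode : ∀ x ∈ W, ∀ t : ℝ, 0 ≤ t →
      HasDerivWithinAt (φ x) (f (φ x t)) (Set.Ici 0) t)
    (hφlim : ∀ x ∈ W, Tendsto (φ x) atTop (nhds 0))
    (Lo : EuclideanSpace ℝ (Fin n) → ℝ)
    (hLoInt : ∀ x ∈ W, IntegrableOn (fun t => ‖h (φ x t)‖ ^ 2) (Set.Ioi 0))
    (hLo : ∀ x ∈ W, Lo x = (1/2) * ∫ t in Set.Ioi (0:ℝ), ‖h (φ x t)‖ ^ 2) :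
    Lo 0 = 0 ∧
    ((∀ x ∈ W, DifferentiableAt ℝ Lo x) →
      ∀ x ∈ W, ⟪gradient Lo x, f x⟫ + (1/2) * ‖h x‖ ^ 2 = 0) ∧
    (∀ L : EuclideanSpace ℝ (Fin n) → ℝ, ContDiffOn ℝ 1 L W → L 0 = 0 →
      (∀ x ∈ W, ⟪gradient L x, f x⟫ + (1/2) * ‖h x‖ ^ 2 = 0) →
      ∀ x ∈ W, L x = Lo x) := by
  have hshift : ∀ x ∈ W, ∀ s : ℝ, 0 ≤ s → ∀ t : ℝ, 0 ≤ t → φ (φ x s) t = φ x (s + t) := by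
    intro x hx s hs t ht
    refine forward_solution_unique hf.locallyLipschitz (v := fun t => φ x (s + t))
      (hφode _ (hφW x hx s hs)) (fun r hr => ?_) ?_ ht
    · simpa [Function.comp_def] using (hφode x hx (s + r) (by positivity)).scomp r
        (((hasDerivAt_id r).const_add s).hasDerivWithinAt (s := Set.Ici 0))
        (fun q hq => add_nonneg hs hq)
    · simpa using hφ0 _ (hφW x hx s hs)
  have hcont : ∀ x ∈ W, ContinuousOn (fun t => ‖h (φ x t)‖ ^ 2) (Set.Ici 0) := fun x hx =>
    (hh.comp_continuousOn fun t ht => (hφode x hx t ht).continuousWithinAt).norm.pow 2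
  refine ⟨?_, ?_, ?_⟩
  · have hz : ∀ t : ℝ, 0 ≤ t → φ 0 t = 0 := fun t ht =>
      forward_solution_unique hf.locallyLipschitz (v := fun _ => 0) (hφode 0 h0W)
        (fun r _ => by simpa [hf0] using hasDerivWithinAt_const r (Set.Ici 0) _)
        (hφ0 0 h0W) ht
    rw [hLo 0 h0W, setIntegral_eq_zero_of_forall_eq_zero, mul_zero]
    intro t ht
    simp [hz t (le_of_lt ht), hh0]
  · intro hdiff x hx
    have hLoφ : ∀ s ∈ Set.Ici (0 : ℝ),
        Lo (φ x s) = Lo x - (1/2) * ∫ t in (0 : ℝ)..s, ‖h (φ x t)‖ ^ 2 := by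
      intro s hs
      have hint : ∫ t in Set.Ioi (0 : ℝ), ‖h (φ (φ x s) t)‖ ^ 2
          = ∫ t in Set.Ioi s, ‖h (φ x t)‖ ^ 2 := by
        rw [setIntegral_congr_fun (g := fun t => ‖h (φ x (s + t))‖ ^ 2) measurableSet_Ioi
          (fun t ht => by simp only [hshift x hx s hs t (le_of_lt ht)]),
          setIntegral_Ioi_comp_const_add (fun t => ‖h (φ x t)‖ ^ 2), add_zero]
      rw [hLo _ (hφW x hx s hs), hLo x hx, hint,
        ← intervalIntegral.integral_Ioi_sub_Ioi (hLoInt x hx) hs]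
      ring
    have hchain : HasDerivWithinAt (fun s => Lo (φ x s)) (fderiv ℝ Lo x (f x)) (Set.Ici 0) 0 := by
      have := (hdiff x hx).hasFDerivAt.comp_hasDerivWithinAt_of_eq 0 (hφode x hx 0 le_rfl)
        (hφ0 x hx).symm
      rwa [hφ0 x hx] at this
    have hftc := (((hasDerivWithinAt_integral_Ici_zero (hcont x hx)).const_mul (1/2)).const_sub
      (Lo x)).congr hLoφ (hLoφ 0 Set.self_mem_Ici)
    have heq := (uniqueDiffOn_Ici (0 : ℝ) 0 Set.self_mem_Ici).eq_deriv _ hchain hftc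
    rw [inner_gradient_left, heq, hφ0 x hx]
    ring
  · intro L hL hL0 hpde x hx
    have hdL : ∀ y ∈ W, DifferentiableAt ℝ L y := fun y hy =>
      (hL.differentiableOn one_ne_zero).differentiableAt (hW.mem_nhds hy)
    have hder : ∀ t : ℝ, 0 ≤ t → HasDerivWithinAt (fun s => L (φ x s))
        (-(1/2) * ‖h (φ x t)‖ ^ 2) (Set.Ici 0) t := by
      intro t ht
      have hmem := hφW x hx t ht
      have hp := hpde _ hmem
      rw [inner_gradient_left] at hp
      rw [show -(1/2) * ‖h (φ x t)‖ ^ 2 = fderiv ℝ L (φ x t) (f (φ x t)) by linarith]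
      exact (hdL _ hmem).hasFDerivAt.comp_hasDerivWithinAt t (hφode x hx t ht)
    have hlim : Tendsto (fun s => L (φ x s)) atTop (nhds 0) := by
      have := (hdL 0 h0W).continuousAt.tendsto.comp (hφlim x hx)
      rwa [hL0] at this
    have hint := integral_Ioi_of_hasDerivAt_of_tendsto (hder 0 le_rfl).continuousWithinAt
      (fun t ht => (hder t (le_of_lt ht)).hasDerivAt (Ici_mem_nhds ht))
      ((hLoInt x hx).const_mul (-(1/2))) hlim
    rw [integral_const_mul, hφ0 x hx] at hint
    rw [hLo x hx]
    linarith
end
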